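/- The map B : f ↦ ((x,y) ↦ f(C⁻(x), C⁻(y))), where C⁻(x) = e^{i arccos(x)}, is a bijection from the set of continuous functions f : ∂𝔻 × ∂𝔻 → ℂ that are positive definite (resp. strictly positive definite) on Ω₂ × Ω₂ and invariant under conjugation in both variables (f(e^{iφ}, e^{iψ}) = f(e^{−iφ}, e^{iψ}) = f(e^{iφ}, e^{−iψ}) for all φ, ψ), onto the set of continuous functions on [−1,1] × [−1,1] that are positive definite (resp. strictly positive definite) on S¹ × S¹. -/

import Mathlib

open scoped ComplexOrder

noncomputable section

/-- A kernel `K` on a type `α` is positive definite. -/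
def IsPDKernelT {α : Type*} (K : α → α → ℂ) : Prop :=
  ∀ (L : ℕ) (x : Fin L → α), Function.Injective x →
    ∀ c : Fin L → ℂ, 0 ≤ ∑ μ, ∑ ν, c μ * (starRingEnd ℂ) (c ν) * K (x μ) (x ν)

/-- A kernel `K` on a type `α` is strictly positive definite. -/
def IsSPDKernelT {α : Type*} (K : α → α → ℂ) : Prop :=
  IsPDKernelT K ∧
    ∀ (L : ℕ) (x : Fin L → α), Function.Injective x →
      ∀ c : Fin L → ℂ,
        ∑ μ, ∑ ν, c μ * (starRingEnd ℂ) (c ν) * K (x μ) (x ν) = 0 → c = 0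

/-- The unit circle `∂𝔻 = Ω₂`, as a subtype of ℂ. -/
abbrev CircleC : Type := ↥(Metric.sphere (0 : ℂ) 1)

/-- The unit circle `S¹ ⊆ ℝ²`. -/
abbrev SphereR2 : Type := ↥(Metric.sphere (0 : EuclideanSpace ℝ (Fin 2)) 1)

/-- The interval `[-1, 1]` as a subtype of ℝ. -/
abbrev IccT : Type := ↥(Set.Icc (-1 : ℝ) 1)

/-- The product `z·z' = z conj(z')` on `Ω₂`. -/
def cMul (z w : CircleC) : CircleC :=
  ⟨z.1 * (starRingEnd ℂ) w.1, by
    have hz := mem_sphere_zero_iff_norm.mp z.2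
    have hw := mem_sphere_zero_iff_norm.mp w.2
    rw [mem_sphere_zero_iff_norm, norm_mul]
    simp [hz, hw]⟩

/-- The point `e^{iφ}` of the circle. -/
def circExp (φ : ℝ) : CircleC :=
  ⟨Complex.exp ((φ : ℂ) * Complex.I), by
    rw [mem_sphere_zero_iff_norm, Complex.norm_exp_ofReal_mul_I]⟩

/-- The map `C⁻ : [-1,1] → ∂𝔻`, `x ↦ e^{i arccos x}`. -/
def Cminus (x : IccT) : CircleC := circExp (Real.arccos x.1)

/-- The map `C : ∂𝔻 → [-1,1]`, `e^{iφ} ↦ cos φ`, i.e. `ξ ↦ Re ξ`. -/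
def Cmap (z : CircleC) : IccT :=
  ⟨z.1.re, by
    have hz := mem_sphere_zero_iff_norm.mp z.2
    have := Complex.abs_re_le_norm z.1
    rw [hz] at this
    exact abs_le.mp this⟩

/-- The Euclidean inner product of two points of `S¹`, landing in `[-1,1]`. -/
def rdot (u v : SphereR2) : IccT :=
  ⟨@inner ℝ _ _ u.1 v.1, by
    have hu := mem_sphere_zero_iff_norm.mp u.2
    have hv := mem_sphere_zero_iff_norm.mp v.2
    have := abs_real_inner_le_norm u.1 v.1
    rw [hu, hv] at this
    simpa using abs_le.mp this⟩


/-- The continuous functions on `∂𝔻 × ∂𝔻` which are PD (`strict = false`) or SPD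
(`strict = true`) on `Ω₂ × Ω₂` and invariant under conjugation in both variables. -/
def classCircle2 (strict : Bool) : Set (CircleC × CircleC → ℂ) :=
  {f | Continuous f ∧
    (if strict then
        IsSPDKernelT (fun zw zw' : CircleC × CircleC =>
          f (cMul zw.1 zw'.1, cMul zw.2 zw'.2))
      else
        IsPDKernelT (fun zw zw' : CircleC × CircleC =>
          f (cMul zw.1 zw'.1, cMul zw.2 zw'.2))) ∧
    (∀ φ ψ : ℝ, f (circExp φ, circExp ψ) = f (circExp (-φ), circExp ψ)) ∧
    (∀ φ ψ : ℝ, f (circExp φ, circExp ψ) = f (circExp φ, circExp (-ψ)))}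

/-- The continuous functions on `[-1,1]²` which are PD (`strict = false`) or SPD
(`strict = true`) on `S¹ × S¹`. -/
def classS1S1 (strict : Bool) : Set (IccT × IccT → ℂ) :=
  {g | Continuous g ∧
    (if strict then
        IsSPDKernelT (fun u v : SphereR2 × SphereR2 =>
          g (rdot u.1 v.1, rdot u.2 v.2))
      else
        IsPDKernelT (fun u v : SphereR2 × SphereR2 =>
          g (rdot u.1 v.1, rdot u.2 v.2)))}

theorem IsPDKernelT.comp_injective {α β : Type*} {K : β → β → ℂ} (hK : IsPDKernelT K)
    {e : α → β} (he : Function.Injective e) : IsPDKernelT (fun a b => K (e a) (e b)) :=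
  fun L x hx c => hK L (e ∘ x) (he.comp hx) c

theorem IsSPDKernelT.comp_injective {α β : Type*} {K : β → β → ℂ} (hK : IsSPDKernelT K)
    {e : α → β} (he : Function.Injective e) : IsSPDKernelT (fun a b => K (e a) (e b)) :=
  ⟨hK.1.comp_injective he, fun L x hx c => hK.2 L (e ∘ x) (he.comp hx) c⟩

/-- The identification of the unit circle of `ℂ` with the unit circle of `ℝ²`. -/
def circleEquivSphere : CircleC ≃ SphereR2 where
  toFun z := ⟨Complex.orthonormalBasisOneI.repr z.1, by
    rw [mem_sphere_zero_iff_norm, LinearIsometryEquiv.norm_map]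
    exact mem_sphere_zero_iff_norm.mp z.2⟩
  invFun u := ⟨Complex.orthonormalBasisOneI.repr.symm u.1, by
    rw [mem_sphere_zero_iff_norm, LinearIsometryEquiv.norm_map]
    exact mem_sphere_zero_iff_norm.mp u.2⟩
  left_inv z := Subtype.ext (LinearIsometryEquiv.symm_apply_apply _ _)
  right_inv u := Subtype.ext (LinearIsometryEquiv.apply_symm_apply _ _)

theorem rdot_circleEquivSphere (z w : CircleC) :
    rdot (circleEquivSphere z) (circleEquivSphere w) = Cmap (cMul z w) := by
  apply Subtype.ext
  change inner ℝ (Complex.orthonormalBasisOneI.repr z.1)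
    (Complex.orthonormalBasisOneI.repr w.1) = (z.1 * (starRingEnd ℂ) w.1).re
  rw [LinearIsometryEquiv.inner_map_map, Complex.inner]
  simp
  ring

theorem continuous_circExp : Continuous circExp :=
  Continuous.subtype_mk (by fun_prop) _

theorem continuous_Cminus : Continuous Cminus :=
  continuous_circExp.comp (Real.continuous_arccos.comp continuous_subtype_val)

theorem continuous_Cmap : Continuous Cmap :=
  Continuous.subtype_mk (Complex.continuous_re.comp continuous_subtype_val) _

theorem Cmap_circExp (φ : ℝ) : (Cmap (circExp φ) : ℝ) = Real.cos φ :=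
  Complex.exp_ofReal_mul_I_re φ

theorem Cmap_Cminus (x : IccT) : Cmap (Cminus x) = x :=
  Subtype.ext ((Cmap_circExp _).trans (Real.cos_arccos x.2.1 x.2.2))

theorem Cmap_circExp_neg (φ : ℝ) : Cmap (circExp (-φ)) = Cmap (circExp φ) :=
  Subtype.ext (by rw [Cmap_circExp, Cmap_circExp, Real.cos_neg])

/-- Every point of the circle is `e^{iφ}` with `C⁻ (C (e^{iφ}))` equal to `e^{iφ}` or `e^{-iφ}`. -/
theorem exists_circExp_eq (z : CircleC) :
    ∃ φ : ℝ, circExp φ = z ∧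
      (Cminus (Cmap z) = circExp φ ∨ Cminus (Cmap z) = circExp (-φ)) := by
  have hz : circExp (Complex.arg z.1) = z := by
    apply Subtype.ext
    have h := Complex.norm_mul_exp_arg_mul_I z.1
    rw [mem_sphere_zero_iff_norm.mp z.2] at h
    simpa [circExp] using h
  have hre : (Cmap z : ℝ) = Real.cos (Complex.arg z.1) := by
    conv_lhs => rw [← hz]
    exact Cmap_circExp _
  refine ⟨Complex.arg z.1, hz, ?_⟩
  rw [Cminus, hre]
  rcases le_total 0 (Complex.arg z.1) with h | h
  · left
    rw [Real.arccos_cos h (Complex.arg_le_pi _)]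
  · right
    rw [← Real.cos_neg, Real.arccos_cos (by linarith)
      (by linarith [Complex.neg_pi_lt_arg z.1])]

theorem apply_Cminus_Cmap {f : CircleC × CircleC → ℂ}
    (h₁ : ∀ φ ψ : ℝ, f (circExp φ, circExp ψ) = f (circExp (-φ), circExp ψ))
    (h₂ : ∀ φ ψ : ℝ, f (circExp φ, circExp ψ) = f (circExp φ, circExp (-ψ)))
    (z w : CircleC) : f (Cminus (Cmap z), Cminus (Cmap w)) = f (z, w) := by
  obtain ⟨φ, hφ, hz⟩ := exists_circExp_eq z
  obtain ⟨ψ, hψ, hw⟩ := exists_circExp_eq w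
  rcases hz with hz | hz <;> rcases hw with hw | hw <;> rw [hz, hw, ← hφ, ← hψ]
  · exact (h₂ φ ψ).symm
  · exact (h₁ φ ψ).symm
  · exact ((h₁ φ ψ).trans (h₂ (-φ) ψ)).symm

/-- A function on `[-1,1]²` is PD (resp. SPD) on `S¹ × S¹` iff its pullback along `C × C` is
PD (resp. SPD) on `Ω₂ × Ω₂`. -/
theorem comp_Cmap_mem_classCircle2_iff (strict : Bool) {g : IccT × IccT → ℂ}
    (hg : Continuous g) :
    (fun zw : CircleC × CircleC => g (Cmap zw.1, Cmap zw.2)) ∈ classCircle2 strict ↔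
      g ∈ classS1S1 strict := by
  have hcont : Continuous fun zw : CircleC × CircleC => g (Cmap zw.1, Cmap zw.2) :=
    hg.comp ((continuous_Cmap.comp continuous_fst).prodMk (continuous_Cmap.comp continuous_snd))
  let e : CircleC × CircleC ≃ SphereR2 × SphereR2 :=
    circleEquivSphere.prodCongr circleEquivSphere
  have hker : (fun a b : CircleC × CircleC =>
      g (Cmap (cMul a.1 b.1), Cmap (cMul a.2 b.2))) =
      fun a b => g (rdot (e a).1 (e b).1, rdot (e a).2 (e b).2) := by
    funext a b
    simp [e, rdot_circleEquivSphere]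
  have hker' : (fun u v : SphereR2 × SphereR2 => g (rdot u.1 v.1, rdot u.2 v.2)) =
      fun u v => (fun a b : CircleC × CircleC =>
        g (Cmap (cMul a.1 b.1), Cmap (cMul a.2 b.2))) (e.symm u) (e.symm v) := by
    rw [hker]
    simp
  simp only [classCircle2, classS1S1, Set.mem_ofPred_eq, Cmap_circExp_neg, implies_true,
    and_true, hcont, hg, true_and]
  cases strict
  all_goals
    simp only [Bool.false_eq_true, if_false, if_true]
    refine ⟨fun h => ?_, fun h => ?_⟩
    · rw [hker']
      exact h.comp_injective e.symm.injective
    · rw [hker]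
      exact h.comp_injective e.injective

/-- Lemma 6.2 / `lm_bij_11`: the map
`B : f ↦ ((x,y) ↦ f(C⁻(x), C⁻(y)))` is a bijection from the continuous PD (resp. SPD)
functions on `Ω₂ × Ω₂` invariant under conjugation in both variables onto the
continuous PD (resp. SPD) functions on `S¹ × S¹`. -/
theorem stmt18 (strict : Bool) :
    Set.BijOn
      (fun (f : CircleC × CircleC → ℂ) (x : IccT × IccT) => f (Cminus x.1, Cminus x.2))
      (classCircle2 strict) (classS1S1 strict) := by
  have hinv : ∀ f ∈ classCircle2 strict,
      (fun zw : CircleC × CircleC => f (Cminus (Cmap zw.1), Cminus (Cmap zw.2))) = f :=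
    fun f hf => funext fun zw => apply_Cminus_Cmap hf.2.2.1 hf.2.2.2 zw.1 zw.2
  refine ⟨fun f hf => ?_, fun f hf f' hf' h => ?_, fun g hg => ?_⟩
  · have hcont : Continuous fun x : IccT × IccT => f (Cminus x.1, Cminus x.2) :=
      hf.1.comp ((continuous_Cminus.comp continuous_fst).prodMk
        (continuous_Cminus.comp continuous_snd))
    refine (comp_Cmap_mem_classCircle2_iff strict hcont).mp ?_
    rw [hinv f hf]
    exact hf
  · rw [← hinv f hf, ← hinv f' hf']
    exact funext fun zw => congrFun h (Cmap zw.1, Cmap zw.2)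
  · refine ⟨_, (comp_Cmap_mem_classCircle2_iff strict hg.1).mpr hg, ?_⟩
    funext x
    simp only [Cmap_Cminus]

end
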